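/- Fix ε > 0. Let a < b be reals, k₁ = 2/(b-a), and for x ∈ [a,b] set x̃ = -1 + k₁(x - a) ∈ [-1,1]. Let X' be a random variable distributed according to the PM output density for input x̃, and define the aggregation map Φ₁(x') = (x' + 1)/k₁ + a. Then E[Φ₁(X')] = x; i.e., the transform–perturb–aggregate pipeline of the PM mechanism is an unbiased estimator of the original value x. -/

import Mathlib

open MeasureTheory

lemma aux_int (c d m p q : ℝ) (h : p ≤ q) :
    Integrable ((Set.Icc p q).indicator (fun y : ℝ => (c * y + d) * m)) ∧
    ∫ y, (Set.Icc p q).indicator (fun y : ℝ => (c * y + d) * m) y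
      = (c * ((q ^ 2 - p ^ 2) / 2) + d * (q - p)) * m := by
  constructor
  · rw [integrable_indicator_iff measurableSet_Icc]
    apply Continuous.integrableOn_Icc
    fun_prop
  · rw [integral_indicator measurableSet_Icc, integral_Icc_eq_integral_Ioc,
      ← intervalIntegral.integral_of_le h, intervalIntegral.integral_mul_const,
      intervalIntegral.integral_add, intervalIntegral.integral_const_mul, integral_id,
      intervalIntegral.integral_const, smul_eq_mul]
    · ring
    · apply Continuous.intervalIntegrable; fun_prop
    · apply Continuous.intervalIntegrable; fun_prop

/-- The transform–perturb–aggregate pipeline of the PM mechanism is unbiased: for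
`x ∈ [a,b]`, `x̃ = -1 + k₁(x-a)` lies in `[-1,1]`, and the expectation of
`Φ₁(X') = (X'+1)/k₁ + a` over the PM output `X'` with density `f` for input `x̃`
equals `x`. -/
theorem stmt_11 (ε : ℝ) (hε : 0 < ε) (a b : ℝ) (hab : a < b)
    (x : ℝ) (hx : x ∈ Set.Icc a b) :
    let u : ℝ := Real.exp (ε / 2)
    let s : ℝ := (u + 1) / (u - 1)
    let k₁ : ℝ := 2 / (b - a)
    let xt : ℝ := -1 + k₁ * (x - a)
    let f : ℝ → ℝ := fun x' =>
      if (u * xt - 1) / (u - 1) ≤ x' ∧ x' ≤ (u * xt + 1) / (u - 1) then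
        u * (u - 1) / (2 * (u + 1))
      else if -s ≤ x' ∧ x' ≤ s then (u - 1) / (2 * (u + u ^ 2)) else 0
    let Φ₁ : ℝ → ℝ := fun x' => (x' + 1) / k₁ + a
    xt ∈ Set.Icc (-1 : ℝ) 1 ∧ (∫ x' : ℝ, Φ₁ x' * f x') = x := by
  intro u s k₁ xt f Φ₁
  have hu : 1 < u := Real.one_lt_exp_iff.mpr (by linarith)
  have hu1 : 0 < u - 1 := by linarith
  have hba : 0 < b - a := by linarith
  obtain ⟨hxa, hxb⟩ := hx
  have hk : k₁ = 2 / (b - a) := rfl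
  have hkp : 0 < k₁ := by rw [hk]; positivity
  have hxt : xt = -1 + k₁ * (x - a) := rfl
  have hkb : k₁ * (b - a) = 2 := by rw [hk]; field_simp
  have h1 : -1 ≤ xt := by
    have := mul_nonneg hkp.le (sub_nonneg.mpr hxa)
    linarith
  have h2 : xt ≤ 1 := by
    have := mul_nonneg hkp.le (sub_nonneg.mpr hxb)
    nlinarith
  refine ⟨⟨h1, h2⟩, ?_⟩
  have hs : s = (u + 1) / (u - 1) := rfl
  have hl : -s ≤ (u * xt - 1) / (u - 1) := by
    rw [hs, ← neg_div]
    gcongr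
    nlinarith
  have hr : (u * xt + 1) / (u - 1) ≤ s := by
    rw [hs]
    gcongr
    nlinarith
  have hlr : (u * xt - 1) / (u - 1) ≤ (u * xt + 1) / (u - 1) := by
    gcongr
    linarith
  have hf : ∀ y, f y = if (u * xt - 1) / (u - 1) ≤ y ∧ y ≤ (u * xt + 1) / (u - 1) then
        u * (u - 1) / (2 * (u + 1))
      else if -s ≤ y ∧ y ≤ s then (u - 1) / (2 * (u + u ^ 2)) else 0 := fun _ => rfl
  have hΦ : ∀ y, Φ₁ y = k₁⁻¹ * y + (k₁⁻¹ + a) := by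
    intro y
    change (y + 1) / k₁ + a = _
    ring
  have hxx : x = (xt + 1) / k₁ + a := by
    rw [hxt]; field_simp; ring
  clear_value f Φ₁ xt s k₁ u
  obtain ⟨i1, e1⟩ := aux_int k₁⁻¹ (k₁⁻¹ + a)
    (u * (u - 1) / (2 * (u + 1)) - (u - 1) / (2 * (u + u ^ 2))) _ _ hlr
  obtain ⟨i2, e2⟩ := aux_int k₁⁻¹ (k₁⁻¹ + a) ((u - 1) / (2 * (u + u ^ 2))) _ _
    (hl.trans (hlr.trans hr))
  have key : ∀ y, Φ₁ y * f y = (Set.Icc ((u * xt - 1) / (u - 1)) ((u * xt + 1) / (u - 1))).indicator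
        (fun y : ℝ => (k₁⁻¹ * y + (k₁⁻¹ + a)) *
          (u * (u - 1) / (2 * (u + 1)) - (u - 1) / (2 * (u + u ^ 2)))) y +
        (Set.Icc (-s) s).indicator
        (fun y : ℝ => (k₁⁻¹ * y + (k₁⁻¹ + a)) * ((u - 1) / (2 * (u + u ^ 2)))) y := by
      intro y
      rw [hf, hΦ]
      simp only [Set.indicator_apply, Set.mem_Icc]
      by_cases c1 : (u * xt - 1) / (u - 1) ≤ y ∧ y ≤ (u * xt + 1) / (u - 1)
      · have c2 : -s ≤ y ∧ y ≤ s := ⟨hl.trans c1.1, c1.2.trans hr⟩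
        rw [if_pos c1, if_pos c1, if_pos c2]; ring
      · rw [if_neg c1, if_neg c1]
        split_ifs <;> ring
  rw [integral_congr_ae (Filter.Eventually.of_forall key), integral_add i1 i2, e1, e2, hxx, hs]
  have : u + 1 ≠ 0 := by linarith
  have : u ≠ 0 := by linarith
  have : 1 + u ≠ 0 := by linarith
  have e : u + u ^ 2 = u * (u + 1) := by ring
  rw [e]
  field_simp
  ring
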